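/- Let d ≥ 1 and let h ∈ ℂ[x_0,x_1,x_2] be a nonzero harmonic homogeneous polynomial of degree d. Then irk(h) ≤ 2d. -/

import Mathlib

open MvPolynomial

/-- The linear form with coefficient vector `a`. -/
noncomputable def lin {n : ℕ} (a : Fin n → ℂ) : MvPolynomial (Fin n) ℂ :=
  ∑ i, MvPolynomial.C (a i) * MvPolynomial.X i

/-- The Laplace operator `Δ = ∑ ∂²/∂xᵢ²`. -/
noncomputable def lap {n : ℕ} (p : MvPolynomial (Fin n) ℂ) : MvPolynomial (Fin n) ℂ :=
  ∑ i, MvPolynomial.pderiv i (MvPolynomial.pderiv i p)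

/-- A coefficient vector (linear form) is isotropic if `∑ aᵢ² = 0`. -/
def Isotropic {n : ℕ} (a : Fin n → ℂ) : Prop :=
  ∑ i, (a i) ^ 2 = 0

/-- Isotropic rank: least `r` such that `h` is a sum of `r` `d`-th powers of
isotropic linear forms. -/
noncomputable def irk {n : ℕ} (d : ℕ) (h : MvPolynomial (Fin n) ℂ) : ℕ :=
  sInf {r : ℕ | ∃ ℓ : Fin r → (Fin n → ℂ),
    (∀ j, Isotropic (ℓ j)) ∧ h = ∑ j, (lin (ℓ j)) ^ d}

/-- Waring rank: least `r` such that `h` is a sum of `r` `d`-th powers of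
linear forms. -/
noncomputable def wrk {n : ℕ} (d : ℕ) (h : MvPolynomial (Fin n) ℂ) : ℕ :=
  sInf {r : ℕ | ∃ ℓ : Fin r → (Fin n → ℂ), h = ∑ j, (lin (ℓ j)) ^ d}

/-- Solving a Vandermonde system. -/
lemma vander_solve (n : ℕ) (z : Fin n → ℂ) (hz : Function.Injective z) (c : ℕ → ℂ) :
    ∃ q : Fin n → ℂ, ∀ k, k < n → ∑ i, q i * z i ^ k = c k := by
  have hdet : IsUnit (Matrix.vandermonde z) := by
    rw [Matrix.isUnit_iff_isUnit_det, isUnit_iff_ne_zero, Matrix.det_vandermonde_ne_zero_iff]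
    exact hz
  obtain ⟨q, hq⟩ := (Matrix.vecMul_surjective_iff_isUnit.2 hdet) (fun k : Fin n => c k)
  refine ⟨q, fun k hk => ?_⟩
  have := congrFun hq ⟨k, hk⟩
  simpa [Matrix.vecMul, dotProduct, Matrix.vandermonde_apply] using this

/-- Equality of all moments of order `n` gives equality on all binary forms of degree `n`. -/
lemma moments_to_forms (n r r' : ℕ) (m s t : Fin r → ℂ) (q u v : Fin r' → ℂ)
    (H : ∀ k, k ≤ n → ∑ j, m j * (s j ^ k * t j ^ (n - k)) = ∑ i, q i * (u i ^ k * v i ^ (n - k)))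
    (G : MvPolynomial (Fin 2) ℂ) (hG : G.IsHomogeneous n) :
    ∑ j, m j * eval ![s j, t j] G = ∑ i, q i * eval ![u i, v i] G := by
  simp only [eval_eq', Finset.mul_sum]
  rw [Finset.sum_comm]
  conv_rhs => rw [Finset.sum_comm]
  refine Finset.sum_congr rfl fun e he => ?_
  have hdeg : e 0 + e 1 = n := by
    have := hG (mem_support_iff.1 he)
    rw [Finsupp.weight_apply, Finsupp.sum_fintype _ _ (by simp)] at this
    simpa using this
  have h1 : e 1 = n - e 0 := by omega
  have := congrArg (fun x => coeff e G * x) (H (e 0) (by omega))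
  simp only [Finset.mul_sum, ← h1] at this
  rw [Finset.sum_congr rfl fun j _ => ?_, this, Finset.sum_congr rfl fun j _ => ?_]
  all_goals simp [Fin.prod_univ_two]; try ring

/-- Every nonzero binary form of degree `n` is a combination of `n` powers, in dual form. -/
lemma reduce_points (n : ℕ) (hn : 1 ≤ n) (r : ℕ) (m s t : Fin r → ℂ) :
    ∃ q u v : Fin n → ℂ, ∀ G : MvPolynomial (Fin 2) ℂ, G.IsHomogeneous n →
      ∑ j, m j * eval ![s j, t j] G = ∑ i, q i * eval ![u i, v i] G := by
  set F : Polynomial ℂ := ∑ j, Polynomial.C (m j) *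
    (Polynomial.C (s j) * Polynomial.X + Polynomial.C (t j)) ^ n with hF
  have hFe : ∀ x, F.eval x = ∑ j, m j * (x * s j + t j) ^ n := by
    intro x
    rw [hF, Polynomial.eval_finsetSum]
    refine Finset.sum_congr rfl fun j _ => ?_
    simp [mul_comm (s j)]
  by_cases hF0 : F = 0
  · refine ⟨0, 0, 0, fun G hG => moments_to_forms n r n m s t 0 0 0 (fun k hk => ?_) G hG⟩
    have hc : F.coeff k = 0 := by simp [hF0]
    have hc2 : F.coeff k = (n.choose k : ℂ) * ∑ j, m j * (s j ^ k * t j ^ (n - k)) := by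
      rw [hF, Polynomial.finsetSum_coeff, Finset.mul_sum]
      refine Finset.sum_congr rfl fun j _ => ?_
      rw [Polynomial.coeff_C_mul]
      rw [add_pow, Polynomial.finsetSum_coeff, Finset.sum_eq_single k]
      · rw [mul_pow, ← Polynomial.C_pow, ← Polynomial.C_pow, ← Polynomial.C_eq_natCast,
          mul_assoc, mul_assoc, ← Polynomial.C_mul, Polynomial.coeff_C_mul,
          Polynomial.coeff_X_pow_mul', Polynomial.coeff_C]
        simp
        ring
      · intro l _ hl
        rw [mul_pow, ← Polynomial.C_pow, ← Polynomial.C_pow, ← Polynomial.C_eq_natCast,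
          mul_assoc, mul_assoc, ← Polynomial.C_mul, Polynomial.coeff_C_mul,
          Polynomial.coeff_X_pow_mul', Polynomial.coeff_C]
        split_ifs <;> first | omega | simp
      · intro h
        simp at h
        omega
    rw [hc] at hc2
    have hne : (n.choose k : ℂ) ≠ 0 := by
      exact_mod_cast (Nat.choose_pos hk).ne'
    have := (mul_eq_zero.1 hc2.symm).resolve_left hne
    rw [this]
    simp
  · have hfin : {x | F.IsRoot x}.Finite := Polynomial.finite_setOfPred_isRoot hF0
    obtain ⟨x, hx⟩ := hfin.exists_notMem
    obtain ⟨y, hy⟩ := (hfin.insert x).exists_notMem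
    simp only [Set.mem_insert_iff, not_or, Set.mem_ofPred_eq, Polynomial.IsRoot.def, hFe] at hx hy
    obtain ⟨hyx, hy⟩ := hy
    have hxy : x - y ≠ 0 := sub_ne_zero.2 (Ne.symm hyx)
    set c : ℕ → ℂ := fun k => ∑ j, m j * ((x * s j + t j) ^ k * (y * s j + t j) ^ (n - k)) with hc
    have hcn : c n ≠ 0 := by simpa [hc] using hx
    have hc0 : c 0 ≠ 0 := by simpa [hc] using hy
    obtain ⟨ρ, hρ⟩ := IsAlgClosed.exists_pow_nat_eq (c n / c 0) (n := n) (by omega)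
    have hρ0 : ρ ≠ 0 := by
      rintro rfl
      rw [zero_pow (by omega)] at hρ
      exact (div_ne_zero hcn hc0) hρ.symm
    have hω := Complex.isPrimitiveRoot_exp n (by omega)
    set ω := Complex.exp (2 * Real.pi * Complex.I / n) with hωd
    have hinj : Function.Injective (fun i : Fin n => ρ * ω ^ (i : ℕ)) := by
      intro i j hij
      exact Fin.ext (hω.pow_inj i.2 j.2 (mul_left_cancel₀ hρ0 hij))
    obtain ⟨q, hq⟩ := vander_solve n _ hinj c
    set z : Fin n → ℂ := fun i => ρ * ω ^ (i : ℕ) with hz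
    have hzn : ∀ i, z i ^ n = c n / c 0 := by
      intro i
      simp only [hz]
      rw [mul_pow, hρ, ← pow_mul, mul_comm (i : ℕ), pow_mul, hω.pow_eq_one, one_pow, mul_one]
    have hmom : ∀ k, k ≤ n → ∑ j, m j * ((x * s j + t j) ^ k * (y * s j + t j) ^ (n - k)) =
        ∑ i, q i * (z i ^ k * (1 : ℂ) ^ (n - k)) := by
      intro k hk
      simp only [one_pow, mul_one]
      rcases hk.lt_or_eq with hk | rfl
      · exact (hq k hk).symm
      · change c k = _
        simp only [hzn]
        have h0 := hq 0 (by omega)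
        simp only [pow_zero, mul_one] at h0
        rw [← Finset.sum_mul, h0]
        field_simp
    refine ⟨q, fun i => (z i - 1) / (x - y), fun i => (x - y * z i) / (x - y), fun G hG => ?_⟩
    let g : Fin 2 → MvPolynomial (Fin 2) ℂ :=
      ![C (1 / (x - y)) * (X 0 - X 1), C (1 / (x - y)) * (C x * X 1 - C y * X 0)]
    have hg : ∀ i, (g i).IsHomogeneous 1 := by
      intro i
      fin_cases i
      · exact ((isHomogeneous_X ℂ 0).sub (isHomogeneous_X ℂ 1)).C_mul _
      · exact (((isHomogeneous_X ℂ 1).C_mul _).sub ((isHomogeneous_X ℂ 0).C_mul _)).C_mul _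
    have hG' := hG.aeval g hg
    rw [one_mul] at hG'
    have key := moments_to_forms n r n m _ _ q z (fun _ => 1) hmom _ hG'
    have hev : ∀ a b : ℂ, eval ![a, b] (aeval g G)
        = eval ![(a - b) / (x - y), (x * b - y * a) / (x - y)] G := by
      intro a b
      rw [← aeval_eq_eval, ← aeval_eq_eval]
      change aeval _ (aeval g G) = aeval _ G
      rw [← AlgHom.comp_apply, comp_aeval]
      congr 2
      ext i
      fin_cases i
      · simp [g]; ring
      · simp [g]; ring
    simp only [hev] at key
    convert key using 4 with j _ j _
    · congr 1
      ext i
      fin_cases i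
      · simp; field_simp; try ring
      · simp; field_simp; try ring
    · congr 1
      ext i
      fin_cases i <;> simp

/-- The Laplace operator as a linear map. -/
noncomputable def lapLin : MvPolynomial (Fin 3) ℂ →ₗ[ℂ] MvPolynomial (Fin 3) ℂ :=
  ∑ i : Fin 3, (pderiv i).toLinearMap ∘ₗ (pderiv i).toLinearMap

lemma lapLin_apply (p : MvPolynomial (Fin 3) ℂ) : lapLin p = lap p := by
  simp [lapLin, lap]

lemma pderiv_lin (a : Fin 3 → ℂ) (i : Fin 3) : pderiv i (lin a) = C (a i) := by
  simp [lin, pderiv_X, Pi.single_apply]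

lemma lap_lin_pow (a : Fin 3 → ℂ) (ha : Isotropic a) (d : ℕ) : lap (lin a ^ d) = 0 := by
  have h2 : ∑ i, (C (a i) : MvPolynomial (Fin 3) ℂ) ^ 2 = 0 := by
    simp only [← C_pow, ← map_sum]
    rw [ha, C_0]
  have : lap (lin a ^ d) = ((d : MvPolynomial (Fin 3) ℂ) * ((d - 1 : ℕ) : MvPolynomial (Fin 3) ℂ)
      * lin a ^ (d - 1 - 1)) * ∑ i, (C (a i) : MvPolynomial (Fin 3) ℂ) ^ 2 := by
    rw [lap, Finset.mul_sum]
    refine Finset.sum_congr rfl fun i _ => ?_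
    have hn : ∀ k : ℕ, pderiv i (k : MvPolynomial (Fin 3) ℂ) = 0 := fun k => by
      rw [← map_natCast (C : ℂ →+* MvPolynomial (Fin 3) ℂ), pderiv_C]
    simp only [pderiv_pow, pderiv_mul, pderiv_lin, pderiv_C, hn]
    ring
  rw [this, h2, mul_zero]

/-- A harmonic polynomial is determined by its coefficients of degree at most one in `x₂`. -/
lemma harmonic_unique (g : MvPolynomial (Fin 3) ℂ) (hg : lap g = 0)
    (h1 : ∀ e : Fin 3 →₀ ℕ, e 2 ≤ 1 → coeff e g = 0) : g = 0 := by
  have main : ∀ N : ℕ, ∀ e : Fin 3 →₀ ℕ, e 2 = N → coeff e g = 0 := by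
    intro N
    induction N using Nat.strong_induction_on with
    | _ N ih =>
      intro e he
      by_cases hN : N ≤ 1
      · exact h1 e (by omega)
      · obtain ⟨e', rfl⟩ : ∃ e' : Fin 3 →₀ ℕ,
            e = e' + Finsupp.single 2 1 + Finsupp.single 2 1 := by
          refine ⟨e - Finsupp.single 2 2, ?_⟩
          ext i
          fin_cases i <;> simp
          omega
        have hc : coeff e' (lap g) = 0 := by rw [hg, coeff_zero]
        simp only [lap, Fin.sum_univ_three, coeff_add, coeff_pderiv] at hc
        simp at he
        rw [ih (N - 2) (by omega) (e' + Finsupp.single 0 1 + Finsupp.single 0 1) (by simp; omega),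
          ih (N - 2) (by omega) (e' + Finsupp.single 1 1 + Finsupp.single 1 1) (by simp; omega)] at hc
        simp only [zero_mul, zero_add] at hc
        rcases mul_eq_zero.1 hc with hc | hc
        · rcases mul_eq_zero.1 hc with hc | hc
          · exact hc
          · exact absurd hc (Nat.cast_add_one_ne_zero _)
        · exact absurd hc (Nat.cast_add_one_ne_zero _)
  ext e
  rw [coeff_zero]
  exact main _ e rfl

lemma lin_isHomogeneous (a : Fin 3 → ℂ) : (lin a).IsHomogeneous 1 :=
  IsHomogeneous.sum _ _ _ fun i _ => (isHomogeneous_X ℂ i).C_mul _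

lemma coeff_lin_pow (a : Fin 3 → ℂ) (e : Fin 3 →₀ ℕ) (d : ℕ) (he : e 0 + e 1 + e 2 = d) :
    coeff e (lin a ^ d) = e.multinomial * (a 0 ^ e 0 * a 1 ^ e 1 * a 2 ^ e 2) := by
  have := coeff_linearCombination_X_pow_of_fintype a e d
  rw [Finsupp.sum_fintype _ _ (by simp), Finsupp.prod_fintype _ _ (by simp),
    Fin.prod_univ_three, if_pos (by rw [Fin.sum_univ_three]; exact he)] at this
  rw [← this, lin]
  simp only [smul_eq_C_mul]

/-- Harmonic forms are spanned by powers of isotropic linear forms. -/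
lemma harmonic_span (d : ℕ) (h : MvPolynomial (Fin 3) ℂ)
    (hharm : lap h = 0) (hhom : h.IsHomogeneous d) :
    ∃ (r : ℕ) (p : Fin r → ℂ) (a : Fin r → Fin 3 → ℂ),
      (∀ j, Isotropic (a j)) ∧ h = ∑ j, C (p j) * lin (a j) ^ d := by
  let T : Fin (d + 1) → ℂ := fun j => ((j : ℕ) : ℂ)
  have hT : Function.Injective T := fun i j hij => Fin.ext (Nat.cast_injective (R := ℂ) hij)
  have hz : ∀ j : Fin (d + 1), ∃ z : ℂ, z ^ 2 = -(1 + T j ^ 2) := fun j =>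
    IsAlgClosed.exists_pow_nat_eq _ (by norm_num)
  choose z hz using hz
  have hz0 : ∀ j, z j ≠ 0 := by
    intro j hj
    have h1 := hz j
    rw [hj] at h1
    have h2 : (1 : ℂ) + T j ^ 2 = 0 := by linear_combination h1
    have h3 : ((1 + (j : ℕ) ^ 2 : ℕ) : ℂ) = 0 := by push_cast; exact h2
    have h4 := Nat.cast_eq_zero.1 h3
    omega
  let ex : ℕ → ℕ → ℕ → (Fin 3 →₀ ℕ) := fun a b c => Finsupp.equivFunOnFinite.symm ![a, b, c]
  have hex : ∀ e : Fin 3 →₀ ℕ, e = ex (e 0) (e 1) (e 2) := by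
    intro e
    ext i
    fin_cases i <;> simp [ex]
  have hmul : ∀ e : Fin 3 →₀ ℕ, (e.multinomial : ℂ) ≠ 0 := fun e => by
    have : 0 < e.multinomial := by
      rw [Finsupp.multinomial_eq]
      exact Nat.multinomial_pos _ _
    exact_mod_cast this.ne'
  obtain ⟨A, hA⟩ := vander_solve (d + 1) T hT
    (fun k => coeff (ex (d - k) k 0) h / (ex (d - k) k 0).multinomial)
  obtain ⟨B, hB⟩ := vander_solve (d + 1) T hT
    (fun k => coeff (ex (d - 1 - k) k 1) h / (ex (d - 1 - k) k 1).multinomial)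
  have key : h = ∑ j, C ((A j + B j / z j) / 2) * lin ![1, T j, z j] ^ d
      + ∑ j, C ((A j - B j / z j) / 2) * lin ![1, T j, -z j] ^ d := by
    rw [← sub_eq_zero]
    apply harmonic_unique
    · rw [← lapLin_apply, map_sub, map_add, map_sum, map_sum, lapLin_apply, hharm]
      have e1 : ∀ (c : ℂ) (a : Fin 3 → ℂ), Isotropic a → lapLin (C c * lin a ^ d) = 0 := by
        intro c a ha
        rw [← smul_eq_C_mul, map_smul, lapLin_apply, lap_lin_pow a ha, smul_zero]
      rw [Finset.sum_eq_zero fun j _ => e1 _ _ ?_, Finset.sum_eq_zero fun j _ => e1 _ _ ?_]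
      · simp
      · simp only [Isotropic, Fin.sum_univ_three]
        simp
        linear_combination hz j
      · simp only [Isotropic, Fin.sum_univ_three]
        simp
        linear_combination hz j
    · intro e he
      by_cases hdeg : e 0 + e 1 + e 2 = d
      · simp only [coeff_sub, coeff_add, coeff_sum, coeff_C_mul, coeff_lin_pow _ e d hdeg]
        rw [← Finset.sum_add_distrib, sub_eq_zero]
        have h01 : e 2 = 0 ∨ e 2 = 1 := by omega
        rcases h01 with h2 | h2
        · have hk := hA (e 1) (by omega)
          have hee : ex (d - e 1) (e 1) 0 = e := by
            rw [hex e, h2]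
            simp [ex]
            omega
          simp only [hee] at hk
          rw [eq_div_iff (hmul e)] at hk
          rw [← hk, Finset.sum_mul]
          refine Finset.sum_congr rfl fun j _ => ?_
          simp [h2]
          ring
        · have hk := hB (e 1) (by omega)
          have hee : ex (d - 1 - e 1) (e 1) 1 = e := by
            rw [hex e, h2]
            simp [ex]
            omega
          simp only [hee] at hk
          rw [eq_div_iff (hmul e)] at hk
          rw [← hk, Finset.sum_mul]
          refine Finset.sum_congr rfl fun j _ => ?_
          have := hz0 j
          simp [h2]
          field_simp
          ring
      · have hdeg' : e.degree ≠ d := by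
          rwa [Finsupp.degree_eq_sum, Fin.sum_univ_three]
        have hl : ∀ a : Fin 3 → ℂ, coeff e (lin a ^ d) = 0 := fun a => by
          have := (lin_isHomogeneous a).pow d
          rw [one_mul] at this
          exact this.coeff_eq_zero hdeg'
        simp [coeff_sub, coeff_add, coeff_sum, coeff_C_mul, hl, hhom.coeff_eq_zero hdeg']
  refine ⟨(d + 1) + (d + 1), Fin.append (fun j => (A j + B j / z j) / 2)
    (fun j => (A j - B j / z j) / 2), Fin.append (fun j => ![1, T j, z j])
    (fun j => ![1, T j, -z j]), ?_, ?_⟩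
  · intro j
    refine Fin.addCases (fun j => ?_) (fun j => ?_) j
    · simp only [Isotropic, Fin.sum_univ_three, Fin.append_left]
      simp
      linear_combination hz j
    · simp only [Isotropic, Fin.sum_univ_three, Fin.append_right]
      simp
      linear_combination hz j
  · rw [Fin.sum_univ_add]
    simp only [Fin.append_left, Fin.append_right]
    exact key

/-- The quadratic parametrization of the isotropic cone. -/
noncomputable def isoPt (s t : ℂ) : Fin 3 → ℂ :=
  ![s ^ 2 - t ^ 2, Complex.I * (s ^ 2 + t ^ 2), 2 * s * t]

lemma isoPt_isotropic (s t : ℂ) : Isotropic (isoPt s t) := by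
  simp only [Isotropic, Fin.sum_univ_three, isoPt]
  simp
  linear_combination (s ^ 2 + t ^ 2) ^ 2 * Complex.I_sq

lemma exists_isoPt (a : Fin 3 → ℂ) (ha : Isotropic a) : ∃ s t, a = isoPt s t := by
  simp only [Isotropic, Fin.sum_univ_three] at ha
  obtain ⟨s, hs⟩ := IsAlgClosed.exists_pow_nat_eq ((a 0 - Complex.I * a 1) / 2)
    (n := 2) (by norm_num)
  obtain ⟨t, ht⟩ := IsAlgClosed.exists_pow_nat_eq ((-a 0 - Complex.I * a 1) / 2)
    (n := 2) (by norm_num)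
  have hst : (2 * s * t) ^ 2 = a 2 ^ 2 := by
    have : (2 * s * t) ^ 2 = 4 * s ^ 2 * t ^ 2 := by ring
    rw [this, hs, ht]
    linear_combination -ha + a 1 ^ 2 * Complex.I_sq
  rcases sq_eq_sq_iff_eq_or_eq_neg.1 hst with h | h
  · refine ⟨s, t, ?_⟩
    ext i
    fin_cases i
    · simp [isoPt, hs, ht]; ring
    · simp [isoPt, hs, ht]; linear_combination a 1 * Complex.I_sq
    · simp [isoPt, h]
  · refine ⟨s, -t, ?_⟩
    ext i
    fin_cases i
    · simp [isoPt, hs, ht]; ring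
    · simp [isoPt, hs, ht]; linear_combination a 1 * Complex.I_sq
    · simp [isoPt, h]

lemma lin_smul_pow (d : ℕ) (c : ℂ) (a : Fin 3 → ℂ) :
    lin (c • a) ^ d = C (c ^ d) * lin a ^ d := by
  have : lin (c • a) = C c * lin a := by
    simp [lin, Finset.mul_sum, mul_assoc]
  rw [this, mul_pow, C_pow]

/-- A harmonic form of degree `d ≥ 1` is a sum of `2d` powers of isotropic forms. -/
lemma harmonic_decomp (d : ℕ) (hd : 1 ≤ d) (h : MvPolynomial (Fin 3) ℂ)
    (hharm : lap h = 0) (hhom : h.IsHomogeneous d) :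
    ∃ ℓ : Fin (2 * d) → (Fin 3 → ℂ), (∀ j, Isotropic (ℓ j)) ∧ h = ∑ j, (lin (ℓ j)) ^ d := by
  obtain ⟨r, p, a, ha, hsum⟩ := harmonic_span d h hharm hhom
  choose s t hst using fun j => exists_isoPt (a j) (ha j)
  obtain ⟨q, u, v, hq⟩ := reduce_points (2 * d) (by omega) r p s t
  choose w hw using fun i => IsAlgClosed.exists_pow_nat_eq (q i) (n := d) (by omega)
  refine ⟨fun i => w i • isoPt (u i) (v i), fun i => ?_, ?_⟩
  · have := isoPt_isotropic (u i) (v i)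
    simp only [Isotropic] at this ⊢
    simp only [Pi.smul_apply, smul_eq_mul, mul_pow, ← Finset.mul_sum, this, mul_zero]
  · rw [hsum]
    simp only [lin_smul_pow, hw, hst]
    apply MvPolynomial.funext
    intro x
    let Q : MvPolynomial (Fin 2) ℂ :=
      C (x 0) * (X 0 ^ 2 - X 1 ^ 2) + C (x 1 * Complex.I) * (X 0 ^ 2 + X 1 ^ 2)
        + C (2 * x 2) * (X 0 * X 1)
    have h0 : (X 0 ^ 2 : MvPolynomial (Fin 2) ℂ).IsHomogeneous 2 := isHomogeneous_X_pow 0 2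
    have h1 : (X 1 ^ 2 : MvPolynomial (Fin 2) ℂ).IsHomogeneous 2 := isHomogeneous_X_pow 1 2
    have h2 : (X 0 * X 1 : MvPolynomial (Fin 2) ℂ).IsHomogeneous 2 :=
      (isHomogeneous_X ℂ 0).mul (isHomogeneous_X ℂ 1)
    have hQ : Q.IsHomogeneous 2 :=
      (((h0.sub h1).C_mul _).add ((h0.add h1).C_mul _)).add (h2.C_mul _)
    have hev : ∀ s t : ℂ, eval x (lin (isoPt s t) ^ d) = eval ![s, t] (Q ^ d) := by
      intro s t
      simp only [map_pow]
      congr 1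
      simp [lin, isoPt, Q, Fin.sum_univ_three]
      ring
    simp only [map_sum, map_mul, eval_C, hev]
    exact hq _ (hQ.pow d)

/-- Every nonzero ternary harmonic form of degree `d` has isotropic rank at
most `2d`. -/
theorem stmt5 (d : ℕ) (hd : 1 ≤ d) (h : MvPolynomial (Fin 3) ℂ) (h0 : h ≠ 0)
    (hharm : lap h = 0) (hhom : h.IsHomogeneous d) :
    irk d h ≤ 2 * d := by
  exact Nat.sInf_le (harmonic_decomp d hd h hharm hhom)
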